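/- arXiv:math/0309260 — 3 statements merged into one kernel-verified Lean document; each statement's English description precedes it below -/
import Mathlib

section
/- Let Q be an m×m complex matrix such that for any two eigenvalues λ, μ of Q the difference λ − μ is not a nonzero integer. Then for every nonzero integer k, the linear map on m×m complex matrices X ↦ k·X − (Q·X − X·Q) is bijective. -/
/-- A Sylvester-type uniqueness result: a matrix intertwining two matrices with no common eigenvalue
is zero. -/
theorem Matrix.eq_zero_of_mul_eq_mul_of_disjoint_spectrum {n K : Type*} [Fintype n] [DecidableEq n]
    [Field K] [IsAlgClosed K] {A B X : Matrix n n K} (h : A * X = X * B)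
    (hAB : Disjoint (spectrum K A) (spectrum K B)) : X = 0 := by
  cases isEmpty_or_nonempty n
  · exact Subsingleton.elim _ _
  have hpoly (p : Polynomial K) : Polynomial.aeval A p * X = X * Polynomial.aeval B p := by
    induction p using Polynomial.induction_on' with
    | add p q hp hq => simp only [map_add, add_mul, mul_add, hp, hq]
    | monomial i a =>
      have hpow : A ^ i * X = X * B ^ i :=
        (SemiconjBy.pow_right (show SemiconjBy X B A from h.symm) i).symm
      simp [Polynomial.aeval_monomial, hpow, ← Algebra.smul_def]
  have hunit : IsUnit (Polynomial.aeval A B.charpoly) := by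
    rw [← spectrum.zero_notMem_iff K, spectrum.map_polynomial_aeval_of_degree_pos A B.charpoly
      (by rw [Matrix.charpoly_degree_eq_dim]; exact_mod_cast Fintype.card_pos)]
    rintro ⟨r, hrA, hr⟩
    exact hAB.notMem_of_mem_left hrA (Matrix.mem_spectrum_iff_isRoot_charpoly.mpr hr)
  have hzero := hpoly B.charpoly
  rw [Matrix.aeval_self_charpoly, mul_zero] at hzero
  exact hunit.mul_right_eq_zero.mp hzero

/-- Under the non-resonance condition (no two eigenvalues of `Q`, i.e. roots
of its characteristic polynomial, differ by a nonzero integer), for every nonzero integer `k`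
the linear map `X ↦ k·X − (Q·X − X·Q)` on `m×m` complex matrices is bijective. -/
theorem nonresonant_ad_map_bijective (m : ℕ) (hm : 0 < m)
    (Q : Matrix (Fin m) (Fin m) ℂ)
    (hres : ∀ lam mu : ℂ, (Matrix.charpoly Q).IsRoot lam →
      (Matrix.charpoly Q).IsRoot mu → ∀ k : ℤ, k ≠ 0 → lam - mu ≠ (k : ℂ)) :
    ∀ k : ℤ, k ≠ 0 →
      Function.Bijective
        (fun X : Matrix (Fin m) (Fin m) ℂ => (k : ℂ) • X - (Q * X - X * Q)) := by
  intro k hk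
  let f : Matrix (Fin m) (Fin m) ℂ →ₗ[ℂ] Matrix (Fin m) (Fin m) ℂ :=
    (k : ℂ) • LinearMap.id - (LinearMap.mulLeft ℂ Q - LinearMap.mulRight ℂ Q)
  have hf : Function.Injective f := by
    refine (injective_iff_map_eq_zero f).mpr fun X hX => ?_
    replace hX : (k : ℂ) • X - (Q * X - X * Q) = 0 := hX
    refine Matrix.eq_zero_of_mul_eq_mul_of_disjoint_spectrum
      (A := Q - algebraMap ℂ _ (k : ℂ)) (B := Q) ?_ ?_
    · rw [sub_mul, ← Algebra.smul_def, sub_eq_iff_eq_add, ← sub_eq_iff_eq_add']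
      exact (sub_eq_zero.mp hX).symm
    · refine Set.disjoint_left.mpr fun r hr hrQ => ?_
      rw [← spectrum.sub_singleton_eq, Set.sub_singleton] at hr
      obtain ⟨s, hs, rfl⟩ := hr
      exact hres s (s - k) (Matrix.mem_spectrum_iff_isRoot_charpoly.mp hs)
        (Matrix.mem_spectrum_iff_isRoot_charpoly.mp hrQ) k hk (sub_sub_cancel s _)
  exact ⟨hf, LinearMap.injective_iff_surjective.mp hf⟩
end

section
/- Let t_1, …, t_{2s} be pairwise distinct complex numbers, A_P = diag(t_1, …, t_s), A_Z = diag(t_{s+1}, …, t_{2s}). Let C_P, C_Z be m×s complex matrices, B_P, B_Z be s×m complex matrices, and S an s×s complex matrix. Assume: (i) every column of C_P is nonzero and every row of B_Z is nonzero; (ii) S satisfies the Sylvester equation A_P·S − S·A_Z = B_P·C_Z; (iii) for every x ∈ ℂ with x ∉ {t_1, …, t_{2s}}, (I + C_P·(x·I − A_P)^{-1}·B_P)·(I + C_Z·(x·I − A_Z)^{-1}·B_Z) = I. Then C_P·S = C_Z and S·B_Z = −B_P. -/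
open Filter Topology in
/-- Simple fractions with distinct poles are linearly independent. -/
theorem eq_zero_of_sum_div_sub_eq_zero {ι : Type*} [Fintype ι]
    {t : ι → ℂ} (ht : Function.Injective t) {a : ι → ℂ}
    (h : ∀ x, (∀ i, x ≠ t i) → ∑ i, a i * (x - t i)⁻¹ = 0) (k : ι) : a k = 0 := by
  classical
  let f : ℂ → ℂ := fun x => ∑ i, a i * (if i = k then 1 else (x - t k) * (x - t i)⁻¹)
  have hf : ContinuousAt f (t k) := by
    refine tendsto_finsetSum _ fun i _ => ?_
    by_cases hi : i = k
    · simpa only [hi, if_true] using tendsto_const_nhds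
    · have hne : t k - t i ≠ 0 := sub_ne_zero.2 fun e => hi (ht e).symm
      simp only [hi, if_false]
      have : ContinuousAt (fun x => a i * ((x - t k) * (x - t i)⁻¹)) (t k) := by
        fun_prop (disch := exact hne)
      exact this
  have hfk : f (t k) = a k := by simp [f]
  have hev : ∀ᶠ x in 𝓝[≠] (t k), f x = 0 := by
    have hpoles : ∀ᶠ x in 𝓝[≠] (t k), ∀ i, x ≠ t i := by
      refine eventually_all.2 fun i => ?_
      by_cases hi : i = k
      · subst hi
        exact eventually_mem_nhdsWithin
      · exact (eventually_ne_nhds fun e => hi (ht e).symm).filter_mono nhdsWithin_le_nhds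
    filter_upwards [hpoles] with x hx
    rw [← mul_zero (x - t k), ← h x hx, Finset.mul_sum]
    refine Finset.sum_congr rfl fun i _ => ?_
    split_ifs with hi
    · subst hi
      have := sub_ne_zero.2 (hx i)
      field_simp
    · ring
  rw [← hfk]
  exact tendsto_nhds_unique (hf.mono_left nhdsWithin_le_nhds)
    (tendsto_const_nhds.congr' (hev.mono fun _ hx => hx.symm))

theorem smul_one_sub_diagonal_eq {n : Type*} [DecidableEq n] (t : n → ℂ) (x : ℂ) :
    x • (1 : Matrix n n ℂ) - Matrix.diagonal t = Matrix.diagonal fun i => x - t i := by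
  rw [Matrix.smul_one_eq_diagonal, Matrix.diagonal_sub]

theorem inv_smul_one_sub_diagonal {n : Type*} [Fintype n] [DecidableEq n] {t : n → ℂ} {x : ℂ}
    (hx : ∀ i, x ≠ t i) :
    (x • (1 : Matrix n n ℂ) - Matrix.diagonal t)⁻¹ = Matrix.diagonal fun i => (x - t i)⁻¹ := by
  rw [smul_one_sub_diagonal_eq]
  refine Matrix.inv_eq_right_inv ?_
  rw [Matrix.diagonal_mul_diagonal, ← Matrix.diagonal_one]
  congr 1
  funext i
  exact mul_inv_cancel₀ (sub_ne_zero.2 (hx i))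

/-- The Sylvester equation turns a product of two realizations into a sum of simple fractions. -/
theorem realization_mul_realization {m n : Type*} [Fintype m] [DecidableEq m] [Fintype n]
    [DecidableEq n] {tP tZ : n → ℂ} {CP CZ : Matrix m n ℂ} {BP BZ : Matrix n m ℂ}
    {S : Matrix n n ℂ}
    (hS : Matrix.diagonal tP * S - S * Matrix.diagonal tZ = BP * CZ) {x : ℂ}
    (hP : ∀ i, x ≠ tP i) (hZ : ∀ i, x ≠ tZ i) :
    (1 + CP * (x • (1 : Matrix n n ℂ) - Matrix.diagonal tP)⁻¹ * BP) *
      (1 + CZ * (x • (1 : Matrix n n ℂ) - Matrix.diagonal tZ)⁻¹ * BZ) =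
    1 + CP * Matrix.diagonal (fun i => (x - tP i)⁻¹) * (BP + S * BZ) +
      (CZ - CP * S) * Matrix.diagonal (fun i => (x - tZ i)⁻¹) * BZ := by
  rw [inv_smul_one_sub_diagonal hP, inv_smul_one_sub_diagonal hZ]
  set RP := Matrix.diagonal fun i => (x - tP i)⁻¹ with hRP
  set RZ := Matrix.diagonal fun i => (x - tZ i)⁻¹ with hRZ
  have key : RP * (BP * CZ) * RZ = RP * S - S * RZ := by
    rw [← hS]
    ext i j
    have h1 := sub_ne_zero.2 (hP i)
    have h2 := sub_ne_zero.2 (hZ j)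
    simp only [hRP, hRZ, Matrix.mul_diagonal, Matrix.diagonal_mul, Matrix.sub_apply]
    field_simp
    ring
  have hmul : CP * RP * BP * (CZ * RZ * BZ) = CP * (RP * S - S * RZ) * BZ := by
    rw [← key]
    simp only [Matrix.mul_assoc]
  rw [Matrix.add_mul, Matrix.mul_add, Matrix.mul_add, hmul]
  simp only [Matrix.mul_add, Matrix.mul_sub, Matrix.sub_mul, Matrix.mul_one, Matrix.one_mul,
    Matrix.mul_assoc]
  abel


/-- **Gohberg–Kaashoek–Lerer–Rodman, relations.** If
`Y(x) = I + C_P (xI − A_P)⁻¹ B_P` and `I + C_Z (xI − A_Z)⁻¹ B_Z` multiply to `I`, and `S`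
solves the Sylvester equation `A_P S − S A_Z = B_P C_Z`, then `C_P S = C_Z` and
`S B_Z = −B_P`.  Here `A_P = diag(t_1,…,t_s)` and `A_Z = diag(t_{s+1},…,t_{2s})` for
pairwise distinct `t_1,…,t_{2s}` (encoded as two injective families `tP`, `tZ` with
disjoint ranges). -/
theorem gklr_relations (m s : ℕ) (hm : 0 < m) (hs : 0 < s)
    (tP tZ : Fin s → ℂ) (htP : Function.Injective tP) (htZ : Function.Injective tZ)
    (htPZ : ∀ α β, tP α ≠ tZ β)
    (CP CZ : Matrix (Fin m) (Fin s) ℂ) (BP BZ : Matrix (Fin s) (Fin m) ℂ)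
    (S : Matrix (Fin s) (Fin s) ℂ)
    (hCP : ∀ α, ∃ i, CP i α ≠ 0) (hBZ : ∀ α, ∃ i, BZ α i ≠ 0)
    (hS : Matrix.diagonal tP * S - S * Matrix.diagonal tZ = BP * CZ)
    (hYZ : ∀ x : ℂ, (∀ α, x ≠ tP α) → (∀ α, x ≠ tZ α) →
      (1 + CP * (x • (1 : Matrix (Fin s) (Fin s) ℂ) - Matrix.diagonal tP)⁻¹ * BP) *
      (1 + CZ * (x • (1 : Matrix (Fin s) (Fin s) ℂ) - Matrix.diagonal tZ)⁻¹ * BZ) = 1) :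
    CP * S = CZ ∧ S * BZ = -BP := by
  have hsum : ∀ i j, ∀ γ : Fin s ⊕ Fin s,
      Sum.elim (fun α => CP i α * (BP + S * BZ) α j) (fun β => (CZ - CP * S) i β * BZ β j) γ
        = 0 := by
    intro i j
    refine eq_zero_of_sum_div_sub_eq_zero (t := Sum.elim tP tZ)
      (htP.sumElim htZ htPZ) fun x hx => ?_
    have hP : ∀ α, x ≠ tP α := fun α => hx (Sum.inl α)
    have hZ : ∀ β, x ≠ tZ β := fun β => hx (Sum.inr β)
    have h := hYZ x hP hZ
    rw [realization_mul_realization hS hP hZ, add_assoc, add_eq_left] at h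
    have hij := congrFun (congrFun h i) j
    rw [Matrix.add_apply, Matrix.mul_apply, Matrix.mul_apply] at hij
    simp only [Matrix.mul_diagonal, Matrix.zero_apply] at hij
    rw [Fintype.sum_sum_type, ← hij]
    simp only [Sum.elim_inl, Sum.elim_inr, mul_right_comm]
  constructor
  · ext i β
    obtain ⟨j, hj⟩ := hBZ β
    exact (sub_eq_zero.1 ((mul_eq_zero.1 (hsum i j (Sum.inr β))).resolve_right hj)).symm
  · ext α j
    obtain ⟨i, hi⟩ := hCP α
    exact eq_neg_of_add_eq_zero_right ((mul_eq_zero.1 (hsum i j (Sum.inl α))).resolve_left hi)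
end

section
/- Let t_1, …, t_{2s} be pairwise distinct complex numbers, A_P = diag(t_1, …, t_s), A_Z = diag(t_{s+1}, …, t_{2s}). Let C_Z be an m×s complex matrix and B_P an s×m complex matrix, and let S_PZ be the s×s matrix with entries (S_PZ)_{αβ} = (B_P·C_Z)_{αβ}/(t_α − t_{s+β}) for 1 ≤ α, β ≤ s (so that A_P·S_PZ − S_PZ·A_Z = B_P·C_Z). Assume S_PZ is invertible, and define C_P = C_Z·S_PZ^{-1} and B_Z = −S_PZ^{-1}·B_P. Then for every x ∈ ℂ with x ∉ {t_1, …, t_{2s}}, (I + C_P·(xI − A_P)^{-1}·B_P)·(I + C_Z·(xI − A_Z)^{-1}·B_Z) = I and (I + C_Z·(xI − A_Z)^{-1}·B_Z)·(I + C_P·(xI − A_P)^{-1}·B_P) = I; in particular Y(x) = I + C_P·(xI − A_P)^{-1}·B_P is invertible for every such x, with inverse I + C_Z·(xI − A_Z)^{-1}·B_Z. -/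
/-- A transfer function with state matrix `P` is inverted by the one with state matrix `Z` when
the Sylvester equation `S * Z - P * S = B * C` holds. -/
theorem one_add_transfer_mul_one_add_transfer {m n R : Type*} [Fintype m] [DecidableEq m]
    [Fintype n] [DecidableEq n] [CommRing R] {P Z S : Matrix n n R} {C : Matrix m n R}
    {B : Matrix n m R} (hP : IsUnit P) (hZ : IsUnit Z) (hS : IsUnit S)
    (h : B * C = S * Z - P * S) :
    (1 + (C * S⁻¹) * P⁻¹ * B) * (1 + C * Z⁻¹ * (-(S⁻¹ * B))) = 1 := by
  rw [Matrix.isUnit_iff_isUnit_det] at hP hZ hS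
  have key : S⁻¹ * P⁻¹ * (B * C) * Z⁻¹ * S⁻¹ = S⁻¹ * P⁻¹ - Z⁻¹ * S⁻¹ := by
    have h₁ : S⁻¹ * P⁻¹ * (S * Z) * Z⁻¹ * S⁻¹ = S⁻¹ * P⁻¹ := by
      rw [← Matrix.mul_assoc, Matrix.mul_nonsing_inv_cancel_right _ _ hZ,
        Matrix.mul_nonsing_inv_cancel_right _ _ hS]
    have h₂ : S⁻¹ * P⁻¹ * (P * S) * Z⁻¹ * S⁻¹ = Z⁻¹ * S⁻¹ := by
      rw [← Matrix.mul_assoc, Matrix.nonsing_inv_mul_cancel_right _ _ hP,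
        Matrix.nonsing_inv_mul _ hS, Matrix.one_mul]
    rw [h, Matrix.mul_sub, Matrix.sub_mul, Matrix.sub_mul, h₁, h₂]
  have cross : (C * S⁻¹) * P⁻¹ * B * (C * Z⁻¹ * (S⁻¹ * B))
      = C * S⁻¹ * P⁻¹ * B - C * Z⁻¹ * (S⁻¹ * B) := by
    calc _ = C * (S⁻¹ * P⁻¹ * (B * C) * Z⁻¹ * S⁻¹) * B := by simp only [Matrix.mul_assoc]
      _ = _ := by rw [key]; simp only [Matrix.mul_sub, Matrix.sub_mul, Matrix.mul_assoc]
  rw [Matrix.mul_neg, ← sub_eq_add_neg, Matrix.mul_sub, Matrix.add_mul _ _ (C * Z⁻¹ * _), cross]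
  simp only [Matrix.mul_one, Matrix.one_mul]
  abel

/-- `x • 1 - diagonal t` is invertible when `x` avoids the entries of `t`. -/
theorem isUnit_smul_one_sub_diagonal {n K : Type*} [Fintype n] [DecidableEq n] [Field K]
    {t : n → K} {x : K} (hx : ∀ i, x ≠ t i) :
    IsUnit (x • (1 : Matrix n n K) - Matrix.diagonal t) := by
  rw [Matrix.smul_one_eq_diagonal, Matrix.diagonal_sub, Matrix.isUnit_diagonal, Pi.isUnit_iff]
  exact fun i => (sub_ne_zero.mpr (hx i)).isUnit

/-- **Gohberg–Kaashoek–Lerer–Rodman, existence.** If the Sylvester solution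
`S_PZ` (with entries `(B_P C_Z)_{αβ}/(t_α − t_{s+β})`) is invertible, then with
`C_P = C_Z S_PZ⁻¹` and `B_Z = −S_PZ⁻¹ B_P`, the function
`Y(x) = I + C_P (xI − A_P)⁻¹ B_P` is invertible off `{t_1,…,t_{2s}}`, with inverse
`I + C_Z (xI − A_Z)⁻¹ B_Z`. -/
theorem gklr_existence (m s : ℕ) (hm : 0 < m) (hs : 0 < s)
    (tP tZ : Fin s → ℂ) (htP : Function.Injective tP) (htZ : Function.Injective tZ)
    (htPZ : ∀ α β, tP α ≠ tZ β)
    (CZ : Matrix (Fin m) (Fin s) ℂ) (BP : Matrix (Fin s) (Fin m) ℂ)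
    (SPZ : Matrix (Fin s) (Fin s) ℂ)
    (hSPZ : ∀ α β, SPZ α β = (BP * CZ) α β / (tP α - tZ β))
    (hinv : IsUnit SPZ) :
    ∀ x : ℂ, (∀ α, x ≠ tP α) → (∀ α, x ≠ tZ α) →
      (1 + (CZ * SPZ⁻¹) * (x • (1 : Matrix (Fin s) (Fin s) ℂ) - Matrix.diagonal tP)⁻¹ * BP) *
        (1 + CZ * (x • (1 : Matrix (Fin s) (Fin s) ℂ) - Matrix.diagonal tZ)⁻¹ *
          (-(SPZ⁻¹ * BP))) = 1 ∧
      (1 + CZ * (x • (1 : Matrix (Fin s) (Fin s) ℂ) - Matrix.diagonal tZ)⁻¹ *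
          (-(SPZ⁻¹ * BP))) *
        (1 + (CZ * SPZ⁻¹) * (x • (1 : Matrix (Fin s) (Fin s) ℂ) - Matrix.diagonal tP)⁻¹ * BP)
        = 1 := by
  intro x hxP hxZ
  have sylvester : BP * CZ = SPZ * (x • (1 : Matrix (Fin s) (Fin s) ℂ) - Matrix.diagonal tZ)
      - (x • (1 : Matrix (Fin s) (Fin s) ℂ) - Matrix.diagonal tP) * SPZ := by
    ext α β
    have hne : tP α - tZ β ≠ 0 := sub_ne_zero.mpr (htPZ α β)
    simp only [Matrix.smul_one_eq_diagonal, Matrix.diagonal_sub, Matrix.sub_apply,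
      Matrix.mul_diagonal, Matrix.diagonal_mul, hSPZ]
    field_simp
    ring
  have hprod := one_add_transfer_mul_one_add_transfer (isUnit_smul_one_sub_diagonal hxP)
    (isUnit_smul_one_sub_diagonal hxZ) hinv sylvester
  exact ⟨hprod, mul_eq_one_comm.mp hprod⟩
end
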